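/- There exists a constant L>0 such that for every finite word 𝔦∈𝓘* and all 0 ≤ a < b ≤ 1, writing S_𝔦(x,y) = (f_𝔦(x), g_𝔦(x,y)), one has |g_𝔦(b,1) − g_𝔦(a,1)| ≤ L·|f_𝔦(b) − f_𝔦(a)|. -/

import Mathlib

/-!
Setting (Falconer–Fraser–Lee, "L^q-spectra of measures on planar non-conformal attractors"):
a finite family of C^{1+α} skew-product contractions
`S i (x,y) = (f i x, g i (x,y))` of the unit square, satisfying a domination
condition on the (lower triangular) Jacobians.
-/

open Set Filter Topology MeasureTheory
open scoped Classical ENNReal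

noncomputable section

/-- The closed unit square `[0,1]² ⊆ ℝ²`. -/
def unitSq : Set (ℝ × ℝ) := Set.Icc (0:ℝ) 1 ×ˢ Set.Icc (0:ℝ) 1

variable {ι : Type*} [Fintype ι]

/-- The skew-product map `S_i(x,y) = (f_i x, g_i (x,y))`. -/
def Smap (f : ι → ℝ → ℝ) (g : ι → ℝ × ℝ → ℝ) (i : ι) : ℝ × ℝ → ℝ × ℝ :=
  fun a => (f i a.1, g i a)

/-- The composition `S_𝔦 = S_{i₁} ∘ ⋯ ∘ S_{i_k}` along a finite word `𝔦 = [i₁, …, i_k]`. -/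
def Sword (f : ι → ℝ → ℝ) (g : ι → ℝ × ℝ → ℝ) : List ι → ℝ × ℝ → ℝ × ℝ
  | [] => id
  | i :: l => Smap f g i ∘ Sword f g l

/-- The first component `f_𝔦 = f_{i₁} ∘ ⋯ ∘ f_{i_k}` of `S_𝔦` (a function of `x` only). -/
def fword (f : ι → ℝ → ℝ) : List ι → ℝ → ℝ
  | [] => id
  | i :: l => f i ∘ fword f l

/-- Top-left entry `f_{𝔦,x}(a)` of the (lower triangular) Jacobian `D_a S_𝔦`. -/
def fxw (f : ι → ℝ → ℝ) (g : ι → ℝ × ℝ → ℝ) (l : List ι) (a : ℝ × ℝ) : ℝ :=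
  deriv (fun x => (Sword f g l (x, a.2)).1) a.1

/-- Bottom-left entry `g_{𝔦,x}(a)` of the Jacobian `D_a S_𝔦`. -/
def gxw (f : ι → ℝ → ℝ) (g : ι → ℝ × ℝ → ℝ) (l : List ι) (a : ℝ × ℝ) : ℝ :=
  deriv (fun x => (Sword f g l (x, a.2)).2) a.1

/-- Bottom-right entry `g_{𝔦,y}(a)` of the Jacobian `D_a S_𝔦`. -/
def gyw (f : ι → ℝ → ℝ) (g : ι → ℝ × ℝ → ℝ) (l : List ι) (a : ℝ × ℝ) : ℝ :=
  deriv (fun y => (Sword f g l (a.1, y)).2) a.2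

/-- The standing hypotheses: `|𝓘| ≥ 2`; each `S_i(x,y) = (f_i x, g_i(x,y))` maps the unit
square into itself; `f_i, g_i` are `C^{1+α}` contractions (`0 < α ≤ 1`); and the
domination condition `inf f_{i,x} > sup g_{i,y} ≥ inf g_{i,y} ≥ d > 0` holds. -/
structure IFSHyp (f : ι → ℝ → ℝ) (g : ι → ℝ × ℝ → ℝ) (α d : ℝ) : Prop where
  card2 : 2 ≤ Fintype.card ι
  alpha_pos : 0 < α
  alpha_le_one : α ≤ 1
  d_pos : 0 < d
  maps_f : ∀ i, Set.MapsTo (f i) (Set.Icc 0 1) (Set.Icc 0 1)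
  maps_g : ∀ i, Set.MapsTo (g i) unitSq (Set.Icc 0 1)
  diff_f : ∀ i, Differentiable ℝ (f i)
  diff_g : ∀ i, Differentiable ℝ (g i)
  holder_f : ∀ i, ∃ H : ℝ, ∀ x ∈ Set.Icc (0:ℝ) 1, ∀ y ∈ Set.Icc (0:ℝ) 1,
      |deriv (f i) x - deriv (f i) y| ≤ H * |x - y| ^ α
  holder_g : ∀ i, ∃ H : ℝ, ∀ a ∈ unitSq, ∀ b ∈ unitSq,
      ‖fderiv ℝ (g i) a - fderiv ℝ (g i) b‖ ≤ H * ‖a - b‖ ^ α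
  contr_f : ∀ i, ∃ c, 0 ≤ c ∧ c < 1 ∧ ∀ x ∈ Set.Icc (0:ℝ) 1, ∀ y ∈ Set.Icc (0:ℝ) 1,
      |f i x - f i y| ≤ c * |x - y|
  contr_g : ∀ i, ∃ c, 0 ≤ c ∧ c < 1 ∧ ∀ a ∈ unitSq, ∀ b ∈ unitSq,
      |g i a - g i b| ≤ c * ‖a - b‖
  dom : ∀ i, sSup (gyw f g [i] '' unitSq) < sInf (fxw f g [i] '' unitSq)
  dom_d : ∀ i, ∀ a ∈ unitSq, d ≤ gyw f g [i] a

/-- The larger singular value of the lower triangular matrix `A = [[a,0],[b,c]]`, i.e. the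
square root of the larger eigenvalue of `AᵀA`, in explicit closed form. -/
def sv1 (a b c : ℝ) : ℝ :=
  Real.sqrt (((a ^ 2 + b ^ 2 + c ^ 2) +
    Real.sqrt ((a ^ 2 + b ^ 2 + c ^ 2) ^ 2 - 4 * (a * c) ^ 2)) / 2)

/-- The smaller singular value of the lower triangular matrix `A = [[a,0],[b,c]]`, i.e. the
square root of the smaller eigenvalue of `AᵀA`, in explicit closed form. -/
def sv2 (a b c : ℝ) : ℝ :=
  Real.sqrt (((a ^ 2 + b ^ 2 + c ^ 2) -
    Real.sqrt ((a ^ 2 + b ^ 2 + c ^ 2) ^ 2 - 4 * (a * c) ^ 2)) / 2)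

/-- `α₁(D_a S_𝔦)`, the larger singular value of the Jacobian. -/
def alphaOne (f : ι → ℝ → ℝ) (g : ι → ℝ × ℝ → ℝ) (l : List ι) (a : ℝ × ℝ) : ℝ :=
  sv1 (fxw f g l a) (gxw f g l a) (gyw f g l a)

/-- `α₂(D_a S_𝔦)`, the smaller singular value of the Jacobian. -/
def alphaTwo (f : ι → ℝ → ℝ) (g : ι → ℝ × ℝ → ℝ) (l : List ι) (a : ℝ × ℝ) : ℝ :=
  sv2 (fxw f g l a) (gxw f g l a) (gyw f g l a)

/-- `η = sup_{i, a, b} g_{i,y}(a) / f_{i,x}(b)`. -/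
def etaSup (f : ι → ℝ → ℝ) (g : ι → ℝ × ℝ → ℝ) : ℝ :=
  sSup {x : ℝ | ∃ i : ι, ∃ a ∈ unitSq, ∃ b ∈ unitSq, x = gyw f g [i] a / fxw f g [i] b}

/-- `p(𝔦) = p_{i₁} ⋯ p_{i_k}`. -/
def pword (p : ι → ℝ) (l : List ι) : ℝ := (l.map p).prod

/-- `(p_i)` is a probability vector with all entries in `(0,1)`. -/
def ProbVec (p : ι → ℝ) : Prop := (∀ i, 0 < p i ∧ p i < 1) ∧ ∑ i, p i = 1

/-- The `q`-modified singular value function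
`ψ^{s,q}_a(𝔦) = p(𝔦)^q α₁(D_aS_𝔦)^βq α₂(D_aS_𝔦)^(s−βq)` (real exponents). -/
def psiSV (f : ι → ℝ → ℝ) (g : ι → ℝ × ℝ → ℝ) (p : ι → ℝ) (s q βq : ℝ)
    (a : ℝ × ℝ) (l : List ι) : ℝ :=
  pword p l ^ q * alphaOne f g l a ^ βq * alphaTwo f g l a ^ (s - βq)

/-- `Ψ^{s,q}_{a,k} = Σ_{𝔦 ∈ 𝓘^k} ψ^{s,q}_a(𝔦)`. -/
def PsiSum (f : ι → ℝ → ℝ) (g : ι → ℝ × ℝ → ℝ) (p : ι → ℝ) (s q βq : ℝ)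
    (a : ℝ × ℝ) (k : ℕ) : ℝ :=
  ∑ w : Fin k → ι, psiSV f g p s q βq a (List.ofFn w)

/-- The `δ`-stopping `𝓘_{a,δ} = {𝔦 : α₂(D_aS_𝔦) < δ ≤ α₂(D_aS_𝔦̂)}`, where `𝔦̂` drops the
last letter of `𝔦`. -/
def stopping (f : ι → ℝ → ℝ) (g : ι → ℝ × ℝ → ℝ) (a : ℝ × ℝ) (δ : ℝ) : Set (List ι) :=
  {l | l ≠ [] ∧ alphaTwo f g l a < δ ∧ δ ≤ alphaTwo f g l.dropLast a}

/-- `q`-th power moment sum of a measure on `ℝ` over the `δ`-mesh intervals of positive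
measure. -/
def msum1 (ν : Measure ℝ) (q δ : ℝ) : ℝ :=
  ∑' k : ℤ, if 0 < ν (Set.Icc ((k : ℝ) * δ) (((k : ℝ) + 1) * δ)) then
    (ν (Set.Icc ((k : ℝ) * δ) (((k : ℝ) + 1) * δ))).toReal ^ q else 0

/-- `q`-th power moment sum of a measure on `ℝ²` over the `δ`-mesh squares of positive
measure. -/
def msum2 (ν : Measure (ℝ × ℝ)) (q δ : ℝ) : ℝ :=
  ∑' k : ℤ × ℤ,
    if 0 < ν (Set.Icc ((k.1 : ℝ) * δ) (((k.1 : ℝ) + 1) * δ) ×ˢ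
        Set.Icc ((k.2 : ℝ) * δ) (((k.2 : ℝ) + 1) * δ)) then
      (ν (Set.Icc ((k.1 : ℝ) * δ) (((k.1 : ℝ) + 1) * δ) ×ˢ
        Set.Icc ((k.2 : ℝ) * δ) (((k.2 : ℝ) + 1) * δ))).toReal ^ q else 0

/-- Upper `L^q`-spectrum of a measure on `ℝ²`. -/
def upperTau2 (ν : Measure (ℝ × ℝ)) (q : ℝ) : ℝ :=
  limsup (fun δ => Real.log (msum2 ν q δ) / (-Real.log δ)) (𝓝[>] (0:ℝ))

/-- Lower `L^q`-spectrum of a measure on `ℝ²`. -/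
def lowerTau2 (ν : Measure (ℝ × ℝ)) (q : ℝ) : ℝ :=
  liminf (fun δ => Real.log (msum2 ν q δ) / (-Real.log δ)) (𝓝[>] (0:ℝ))

theorem gyw_singleton {κ : Type*} (f : κ → ℝ → ℝ) (g : κ → ℝ × ℝ → ℝ)
    (hg : ∀ i, Differentiable ℝ (g i)) (i : κ) (a : ℝ × ℝ) : gyw f g [i] a = fderiv ℝ (g i) a (0, 1) :=
  HasDerivAt.deriv <| HasFDerivAt.comp_hasDerivAt (l := g i) (f := fun y => (a.1, y)) a.2
    (hg i _).hasFDerivAt ((hasDerivAt_const a.2 a.1).prodMk (hasDerivAt_id a.2))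

theorem IFSHyp.bddAbove_gyw {f : ι → ℝ → ℝ} {g : ι → ℝ × ℝ → ℝ} {α d : ℝ}
    (h : IFSHyp f g α d) (i : ι) : BddAbove (gyw f g [i] '' unitSq) := by
  obtain ⟨H, hH⟩ := h.holder_g i
  have h0 : ((0, 0) : ℝ × ℝ) ∈ unitSq := by simp [unitSq]
  refine ⟨‖fderiv ℝ (g i) (0, 0)‖ + |H|, ?_⟩
  rintro _ ⟨a, ha, rfl⟩
  rw [gyw_singleton f g h.diff_g]
  have hnorm : ‖a - (0, 0)‖ ≤ 1 := by
    obtain ⟨⟨h1, h2⟩, h3, h4⟩ := ha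
    rw [Prod.norm_def]
    simp [abs_of_nonneg h1, abs_of_nonneg h3, h2, h4]
  have hpow : ‖a - (0, 0)‖ ^ α ≤ 1 :=
    Real.rpow_le_one (norm_nonneg _) hnorm h.alpha_pos.le
  have hdist : ‖fderiv ℝ (g i) a - fderiv ℝ (g i) (0, 0)‖ ≤ |H| :=
    (hH a ha _ h0).trans <|
      (mul_le_mul_of_nonneg_right (le_abs_self H) (by positivity)).trans
        (mul_le_of_le_one_right (abs_nonneg H) hpow)
  have happ : ‖fderiv ℝ (g i) a (0, 1)‖ ≤ ‖fderiv ℝ (g i) a‖ := by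
    simpa [Prod.norm_def] using (fderiv ℝ (g i) a).le_opNorm (0, 1)
  have htri := norm_sub_norm_le (fderiv ℝ (g i) a) (fderiv ℝ (g i) (0, 0))
  have hle := le_abs_self (fderiv ℝ (g i) a (0, 1))
  rw [Real.norm_eq_abs] at happ
  linarith

/-- The domination condition as a vertical upper Lipschitz bound for `g i` that is strictly smaller
than a horizontal lower Lipschitz bound for `f i`. -/
theorem IFSHyp.exists_domination_bounds {f : ι → ℝ → ℝ} {g : ι → ℝ × ℝ → ℝ} {α d : ℝ}
    (h : IFSHyp f g α d) (i : ι) : ∃ s m : ℝ, 0 < s ∧ s < m ∧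
      (∀ x ∈ Icc (0 : ℝ) 1, ∀ y ∈ Icc (0 : ℝ) 1, ∀ z ∈ Icc (0 : ℝ) 1,
        |g i (x, y) - g i (x, z)| ≤ s * |y - z|) ∧
      (∀ x ∈ Icc (0 : ℝ) 1, ∀ y ∈ Icc (0 : ℝ) 1, m * |x - y| ≤ |f i x - f i y|) := by
  have hdom := h.dom i
  set s := sSup (gyw f g [i] '' unitSq) with hs
  set m := sInf (fxw f g [i] '' unitSq) with hm
  have h0 : ((0, 0) : ℝ × ℝ) ∈ unitSq := by simp [unitSq]
  have hle : ∀ a ∈ unitSq, gyw f g [i] a ≤ s := fun a ha =>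
    le_csSup (h.bddAbove_gyw i) (mem_image_of_mem _ ha)
  have hspos : 0 < s := h.d_pos.trans_le ((h.dom_d i _ h0).trans (hle _ h0))
  have hbdd : BddBelow (fxw f g [i] '' unitSq) := by
    by_contra hn
    rw [hm, Real.sInf_of_not_bddBelow hn] at hdom
    linarith
  have hge : ∀ x ∈ Icc (0 : ℝ) 1, m ≤ deriv (f i) x := fun x hx =>
    csInf_le hbdd ⟨(x, 0), ⟨hx, by simp⟩, rfl⟩
  refine ⟨s, m, hspos, hdom, fun x hx y hy z hz => ?_, ?_⟩
  · refine Convex.norm_image_sub_le_of_norm_deriv_le (f := fun y => g i (x, y))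
      (fun t _ => (h.diff_g i).comp (by fun_prop : Differentiable ℝ fun y => (x, y)) t)
      (fun t ht => ?_) (convex_Icc (0 : ℝ) 1) hz hy
    have hd := h.dom_d i (x, t) ⟨hx, ht⟩
    rw [Real.norm_eq_abs]
    exact abs_le.2 ⟨by
      change -s ≤ gyw f g [i] (x, t)
      linarith [h.d_pos], hle (x, t) ⟨hx, ht⟩⟩
  · have key : ∀ x ∈ Icc (0 : ℝ) 1, ∀ y ∈ Icc (0 : ℝ) 1, x ≤ y →
        m * |x - y| ≤ |f i x - f i y| := fun x hx y hy hxy => by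
      have := (convex_Icc (0 : ℝ) 1).mul_sub_le_image_sub_of_le_deriv
        (h.diff_f i).continuous.continuousOn (h.diff_f i).differentiableOn
        (fun t ht => hge t (interior_subset ht)) x hx y hy hxy
      rw [abs_sub_comm x, abs_sub_comm (f i x), abs_of_nonneg (sub_nonneg.2 hxy)]
      exact this.trans (le_abs_self _)
    intro x hx y hy
    rcases le_total x y with hxy | hxy
    · exact key x hx y hy hxy
    · simpa [abs_sub_comm] using key y hy x hx hxy

theorem IFSHyp.mapsTo_Sword {f : ι → ℝ → ℝ} {g : ι → ℝ × ℝ → ℝ} {α d : ℝ}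
    (h : IFSHyp f g α d) (l : List ι) : MapsTo (Sword f g l) unitSq unitSq := by
  induction l with
  | nil => exact mapsTo_id _
  | cons i l ih => exact fun a ha => ⟨h.maps_f i (ih ha).1, h.maps_g i (ih ha)⟩

theorem Sword_fst {κ : Type*} (f : κ → ℝ → ℝ) (g : κ → ℝ × ℝ → ℝ) (l : List κ) (a : ℝ × ℝ) :
    (Sword f g l a).1 = fword f l a.1 := by
  induction l with
  | nil => rfl
  | cons i l ih => exact congrArg (f i) ih

/-- For `L` large, every `S i` maps the cone `|Δy| ≤ L * |Δx|` into itself. -/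
theorem IFSHyp.exists_invariant_cone {f : ι → ℝ → ℝ} {g : ι → ℝ × ℝ → ℝ} {α d : ℝ}
    (h : IFSHyp f g α d) : ∃ L : ℝ, 0 < L ∧ ∀ i, ∀ p ∈ unitSq, ∀ q ∈ unitSq,
      |p.2 - q.2| ≤ L * |p.1 - q.1| → |g i p - g i q| ≤ L * |f i p.1 - f i q.1| := by
  choose s m hs hsm hg hf using h.exists_domination_bounds
  have hpos : ∀ i, 0 < (m i - s i)⁻¹ := fun i => inv_pos.2 (sub_pos.2 (hsm i))
  have hsum : 0 ≤ ∑ i, (m i - s i)⁻¹ := Finset.sum_nonneg fun i _ => (hpos i).le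
  refine ⟨1 + ∑ i, (m i - s i)⁻¹, by linarith, fun i p hp q hq hpq => ?_⟩
  have hL : (m i - s i)⁻¹ ≤ 1 + ∑ j, (m j - s j)⁻¹ := by
    have := Finset.single_le_sum (fun j _ => (hpos j).le) (Finset.mem_univ i)
    linarith
  set L := 1 + ∑ j, (m j - s j)⁻¹
  have hL1 : 1 ≤ L * (m i - s i) := (inv_le_iff_one_le_mul₀ (sub_pos.2 (hsm i))).1 hL
  obtain ⟨c, -, hc1, hc⟩ := h.contr_g i
  have hhor : |g i p - g i (q.1, p.2)| ≤ |p.1 - q.1| := by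
    refine (hc p hp (q.1, p.2) ⟨hq.1, hp.2⟩).trans ?_
    have : ‖p - (q.1, p.2)‖ = |p.1 - q.1| := by simp [Prod.norm_def]
    rw [this]
    exact mul_le_of_le_one_left (abs_nonneg _) hc1.le
  have hver : |g i (q.1, p.2) - g i q| ≤ s i * (L * |p.1 - q.1|) :=
    (hg i q.1 hq.1 p.2 hp.2 q.2 hq.2).trans (mul_le_mul_of_nonneg_left hpq (hs i).le)
  have hLnn : 0 ≤ L := by positivity
  calc |g i p - g i q| ≤ |g i p - g i (q.1, p.2)| + |g i (q.1, p.2) - g i q| := abs_sub_le _ _ _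
    _ ≤ |p.1 - q.1| + s i * (L * |p.1 - q.1|) := add_le_add hhor hver
    _ ≤ L * (m i * |p.1 - q.1|) := by nlinarith [abs_nonneg (p.1 - q.1)]
    _ ≤ L * |f i p.1 - f i q.1| := mul_le_mul_of_nonneg_left (hf i _ hp.1 _ hq.1) hLnn

theorem slope_ratio_bounded {ι : Type*} [Fintype ι]
    (f : ι → ℝ → ℝ) (g : ι → ℝ × ℝ → ℝ) (α d : ℝ) (h : IFSHyp f g α d) :
    ∃ L : ℝ, 0 < L ∧ ∀ l : List ι, l ≠ [] → ∀ a b : ℝ, 0 ≤ a → a < b → b ≤ 1 →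
      |(Sword f g l (b, 1)).2 - (Sword f g l (a, 1)).2| ≤ L * |fword f l b - fword f l a| := by
  obtain ⟨L, hL, hcone⟩ := h.exists_invariant_cone
  refine ⟨L, hL, fun l hl a b ha hab hb => ?_⟩
  clear hl
  have hmem : ∀ x ∈ Icc (0 : ℝ) 1, (x, (1 : ℝ)) ∈ unitSq := fun x hx => ⟨hx, by simp⟩
  have hA := hmem a ⟨ha, hab.le.trans hb⟩
  have hB := hmem b ⟨ha.trans hab.le, hb⟩
  induction l with
  | nil => simpa [Sword] using mul_nonneg hL.le (abs_nonneg (fword f [] b - fword f [] a))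
  | cons i l ih =>
    have := hcone i _ (h.mapsTo_Sword l hB) _ (h.mapsTo_Sword l hA) (by
      rw [Sword_fst, Sword_fst]
      exact ih)
    rw [Sword_fst, Sword_fst] at this
    exact this

end
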